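/- The Lévy distribution is stable of index 1/2: for every c > 0 and every n ∈ ℕ with n ≥ 1, if X₁, …, X_n are independent random variables each with the Lévy distribution with parameter c, then n^{−2} ∑_{i=1}^n X_i again has the Lévy distribution with parameter c. Equivalently, the pushforward of the n-fold product of the Lévy(c) measure under the map (x₁,…,x_n) ↦ n^{−2}(x₁ + ⋯ + x_n) equals the Lévy(c) measure. -/

import Mathlib

open MeasureTheory Real

/-- The density of the Lévy distribution with parameter `c > 0`:
`x ↦ √(c/(2π)) x^(−3/2) exp(−c/(2x))` for `x > 0` and `0` for `x ≤ 0`. -/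
noncomputable def levyDensity (c : ℝ) (x : ℝ) : ℝ :=
  if 0 < x then Real.sqrt (c / (2 * Real.pi)) * x ^ (-(3 / 2 : ℝ)) * Real.exp (-c / (2 * x))
  else 0

/-- The Lévy distribution with parameter `c > 0`, as a measure on `ℝ`. -/
noncomputable def levyMeasure (c : ℝ) : Measure ℝ :=
  volume.withDensity fun x => ENNReal.ofReal (levyDensity c x)

open Filter Set ProbabilityTheory
open scoped Topology

/-- The primitive of `u ↦ exp (-u ^ 2)` vanishing at `0`. -/
noncomputable def gaussPrimitive (y : ℝ) : ℝ := ∫ u in (0 : ℝ)..y, exp (-u ^ 2)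

lemma hasDerivAt_gaussPrimitive (y : ℝ) :
    HasDerivAt gaussPrimitive (exp (-y ^ 2)) y :=
  intervalIntegral.integral_hasDerivAt_right
    ((by fun_prop : Continuous fun u : ℝ => exp (-u ^ 2)).intervalIntegrable _ _)
    (by fun_prop : Continuous fun u : ℝ => exp (-u ^ 2)).stronglyMeasurable.stronglyMeasurableAtFilter
    (by fun_prop)

lemma gaussPrimitive_zero : gaussPrimitive 0 = 0 := by simp [gaussPrimitive]

lemma gaussPrimitive_neg (y : ℝ) : gaussPrimitive (-y) = -gaussPrimitive y := by
  have h := intervalIntegral.integral_comp_neg (a := 0) (b := y) fun u : ℝ => exp (-u ^ 2)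
  simp only [even_two, Even.neg_pow, neg_zero] at h
  rw [gaussPrimitive, gaussPrimitive, h, intervalIntegral.integral_symm]

lemma tendsto_gaussPrimitive_atTop : Tendsto gaussPrimitive atTop (𝓝 (√π / 2)) := by
  have hi := integrable_exp_neg_mul_sq one_pos
  have h := integral_gaussian_Ioi 1
  simp only [neg_mul, one_mul, div_one] at hi h
  rw [← h]
  exact intervalIntegral_tendsto_integral_Ioi 0 hi.integrableOn tendsto_id

lemma tendsto_gaussPrimitive_atBot : Tendsto gaussPrimitive atBot (𝓝 (-(√π / 2))) := by
  have h := (tendsto_gaussPrimitive_atTop.comp tendsto_neg_atBot_atTop).neg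
  refine h.congr fun y => ?_
  simp [gaussPrimitive_neg]

/-- A primitive on `(0, ∞)` of `x ↦ a / √π * x ^ (-3 / 2) * exp (-a ^ 2 / x - b ^ 2 * x)`. -/
noncomputable def invGaussPrimitive (a b x : ℝ) : ℝ :=
  -(√π)⁻¹ * (exp (-2 * a * b) * gaussPrimitive (a / √x - b * √x)
    + exp (2 * a * b) * gaussPrimitive (a / √x + b * √x))

lemma hasDerivAt_invGaussPrimitive (a b : ℝ) {x : ℝ} (hx : 0 < x) :
    HasDerivAt (invGaussPrimitive a b)
      (a / √π * x ^ (-(3 / 2 : ℝ)) * exp (-a ^ 2 / x - b ^ 2 * x)) x := by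
  have hs : 0 < √x := sqrt_pos.2 hx
  have hsx : √x ^ 2 = x := sq_sqrt hx.le
  have hd : HasDerivAt (fun y : ℝ => √y) (1 / (2 * √x)) x := hasDerivAt_sqrt hx.ne'
  have hpow : x ^ (-(3 / 2 : ℝ)) = (√x ^ 3)⁻¹ := by
    rw [rpow_neg hx.le, sqrt_eq_rpow, ← rpow_natCast, ← rpow_mul hx.le]
    norm_num
  have hdiv : HasDerivAt (fun y : ℝ => a / √y) (-(a * (1 / (2 * √x))) / √x ^ 2) x := by
    simpa using (hasDerivAt_const x a).fun_div hd hs.ne'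
  have hm := (hasDerivAt_gaussPrimitive (a / √x - b * √x)).comp x (hdiv.sub (hd.const_mul b))
  have hp := (hasDerivAt_gaussPrimitive (a / √x + b * √x)).comp x (hdiv.add (hd.const_mul b))
  have he : ∀ r : ℝ, r ^ 2 = b ^ 2 → exp (-2 * a * r) * exp (-(a / √x - r * √x) ^ 2)
      = exp (-a ^ 2 / x - b ^ 2 * x) := by
    intro r hr
    rw [← exp_add, ← hr]
    congr 1
    rw [← hsx, sqrt_sq hs.le]
    field_simp
    ring
  have hem := he b rfl
  have hep := he (-b) (by ring)
  simp only [neg_mul, mul_neg, neg_neg, sub_neg_eq_add] at hem hep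
  refine (((hm.const_mul (exp (-2 * a * b))).add
    (hp.const_mul (exp (2 * a * b)))).const_mul (-(√π)⁻¹)).congr_deriv ?_
  simp only [neg_mul, ← mul_assoc]
  rw [hem, hep, hpow]
  field_simp
  ring

lemma tendsto_invGaussPrimitive_zero {a : ℝ} (ha : 0 < a) (b : ℝ) :
    Tendsto (invGaussPrimitive a b) (𝓝[>] 0)
      (𝓝 (-(exp (-2 * a * b) + exp (2 * a * b)) / 2)) := by
  have hs : Tendsto (fun x : ℝ => √x) (𝓝[>] 0) (𝓝[>] 0) := by
    refine tendsto_nhdsWithin_iff.2 ⟨?_, ?_⟩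
    · simpa using (continuous_sqrt.tendsto 0).mono_left nhdsWithin_le_nhds
    · filter_upwards [self_mem_nhdsWithin] with x hx using sqrt_pos.2 hx
  have hdiv : Tendsto (fun x : ℝ => a / √x) (𝓝[>] 0) atTop :=
    (tendsto_inv_nhdsGT_zero.comp hs).const_mul_atTop ha
  have hb : ∀ r : ℝ, Tendsto (fun x : ℝ => r * √x) (𝓝[>] 0) (𝓝 0) := fun r => by
    simpa using (tendsto_nhdsWithin_iff.1 hs).1.const_mul r
  have hm : Tendsto (fun x : ℝ => a / √x - b * √x) (𝓝[>] 0) atTop := by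
    simpa [sub_eq_add_neg] using hdiv.atTop_add (hb (-b))
  have hp : Tendsto (fun x : ℝ => a / √x + b * √x) (𝓝[>] 0) atTop := hdiv.atTop_add (hb b)
  have h := (((tendsto_gaussPrimitive_atTop.comp hm).const_mul (exp (-2 * a * b))).add
    ((tendsto_gaussPrimitive_atTop.comp hp).const_mul (exp (2 * a * b)))).const_mul (-(√π)⁻¹)
  have hl : -(exp (-2 * a * b) + exp (2 * a * b)) / 2 = -(√π)⁻¹ *
      (exp (-2 * a * b) * (√π / 2) + exp (2 * a * b) * (√π / 2)) := by
    have : √π ≠ 0 := (sqrt_pos.2 pi_pos).ne'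
    field_simp
  rw [hl]
  exact h

lemma tendsto_invGaussPrimitive_atTop (a : ℝ) {b : ℝ} (hb : 0 ≤ b) :
    Tendsto (invGaussPrimitive a b) atTop
      (𝓝 ((exp (-2 * a * b) - exp (2 * a * b)) / 2)) := by
  have hdiv : Tendsto (fun x : ℝ => a / √x) atTop (𝓝 0) :=
    tendsto_const_nhds.div_atTop tendsto_sqrt_atTop
  rcases hb.eq_or_lt with rfl | hb
  · have hg := ((hasDerivAt_gaussPrimitive 0).continuousAt.tendsto.comp hdiv).const_mul
      (-(√π)⁻¹ * 2)
    simp only [gaussPrimitive_zero, mul_zero] at hg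
    simp only [mul_zero, sub_self, zero_div]
    refine hg.congr fun x => ?_
    simp [invGaussPrimitive]
    ring
  have hs : Tendsto (fun x : ℝ => b * √x) atTop atTop :=
    tendsto_sqrt_atTop.const_mul_atTop hb
  have hm : Tendsto (fun x : ℝ => a / √x - b * √x) atTop atBot := by
    simpa [sub_eq_add_neg] using hdiv.add_atBot (tendsto_neg_atTop_atBot.comp hs)
  have hp : Tendsto (fun x : ℝ => a / √x + b * √x) atTop atTop := hdiv.add_atTop hs
  have h := (((tendsto_gaussPrimitive_atBot.comp hm).const_mul (exp (-2 * a * b))).add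
    ((tendsto_gaussPrimitive_atTop.comp hp).const_mul (exp (2 * a * b)))).const_mul (-(√π)⁻¹)
  have hl : (exp (-2 * a * b) - exp (2 * a * b)) / 2 = -(√π)⁻¹ *
      (exp (-2 * a * b) * -(√π / 2) + exp (2 * a * b) * (√π / 2)) := by
    have : √π ≠ 0 := (sqrt_pos.2 pi_pos).ne'
    field_simp
    ring
  rw [hl]
  exact h

/-- The Laplace transform of the density of the Lévy distribution. -/
lemma integral_Ioi_invGauss {a b : ℝ} (ha : 0 < a) (hb : 0 ≤ b) :
    IntegrableOn (fun x => a / √π * x ^ (-(3 / 2 : ℝ)) * exp (-a ^ 2 / x - b ^ 2 * x)) (Ioi 0) ∧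
    ∫ x in Ioi (0 : ℝ), a / √π * x ^ (-(3 / 2 : ℝ)) * exp (-a ^ 2 / x - b ^ 2 * x)
      = exp (-2 * a * b) := by
  set l := -(exp (-2 * a * b) + exp (2 * a * b)) / 2 with hl
  set g := Function.update (invGaussPrimitive a b) 0 l with hg
  have hcont : ContinuousWithinAt g (Ici 0) 0 := by
    rw [hg, continuousWithinAt_update_same, Ici_sdiff_left]
    exact tendsto_invGaussPrimitive_zero ha b
  have hderiv : ∀ x ∈ Ioi (0 : ℝ), HasDerivAt g
      (a / √π * x ^ (-(3 / 2 : ℝ)) * exp (-a ^ 2 / x - b ^ 2 * x)) x := fun x hx =>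
    (hasDerivAt_invGaussPrimitive a b hx).congr_of_eventuallyEq <| by
      filter_upwards [lt_mem_nhds (mem_Ioi.1 hx)] with y hy
      rw [hg, Function.update_of_ne hy.ne']
  have hpos : ∀ x ∈ Ioi (0 : ℝ),
      0 ≤ a / √π * x ^ (-(3 / 2 : ℝ)) * exp (-a ^ 2 / x - b ^ 2 * x) := fun x hx => by
    have := rpow_nonneg (mem_Ioi.1 hx).le (-(3 / 2 : ℝ))
    positivity
  have htop : Tendsto g atTop (𝓝 ((exp (-2 * a * b) - exp (2 * a * b)) / 2)) :=
    (tendsto_invGaussPrimitive_atTop a hb).congr' <| by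
      filter_upwards [eventually_gt_atTop 0] with y hy
      rw [hg, Function.update_of_ne hy.ne']
  refine ⟨integrableOn_Ioi_deriv_of_nonneg hcont hderiv hpos htop, ?_⟩
  rw [integral_Ioi_of_hasDerivAt_of_nonneg hcont hderiv hpos htop, hg, Function.update_self, hl]
  ring

lemma levyDensity_nonneg (c x : ℝ) : 0 ≤ levyDensity c x := by
  unfold levyDensity
  split_ifs <;> positivity

lemma measurable_levyDensity (c : ℝ) : Measurable (levyDensity c) :=
  Measurable.ite measurableSet_Ioi (by fun_prop) measurable_const

lemma levyDensity_mul_exp {c t : ℝ} (hc : 0 < c) (ht : 0 ≤ t) :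
    (fun x => levyDensity c x * exp (-t * x)) = (Ioi 0).indicator fun x =>
      √(c / 2) / √π * x ^ (-(3 / 2 : ℝ)) * exp (-√(c / 2) ^ 2 / x - √t ^ 2 * x) := by
  ext x
  by_cases hx : 0 < x
  · rw [indicator_of_mem (mem_Ioi.2 hx), levyDensity, if_pos hx, mul_assoc, ← exp_add,
      sq_sqrt (by positivity), sq_sqrt ht, ← sqrt_div (by positivity), div_div]
    congr 2
    field_simp
    ring
  · rw [indicator_of_notMem (by simpa using hx), levyDensity, if_neg hx, zero_mul]

lemma integrable_levyDensity_mul_exp {c t : ℝ} (hc : 0 < c) (ht : 0 ≤ t) :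
    Integrable fun x => levyDensity c x * exp (-t * x) := by
  rw [levyDensity_mul_exp hc ht, integrable_indicator_iff measurableSet_Ioi]
  exact (integral_Ioi_invGauss (by positivity) (by positivity)).1

lemma integral_levyDensity_mul_exp {c t : ℝ} (hc : 0 < c) (ht : 0 ≤ t) :
    ∫ x, levyDensity c x * exp (-t * x) = exp (-√(2 * c * t)) := by
  rw [levyDensity_mul_exp hc ht, integral_indicator measurableSet_Ioi,
    (integral_Ioi_invGauss (by positivity) (by positivity)).2, mul_assoc,
    ← sqrt_mul (by positivity), neg_mul, ← sqrt_sq (zero_le_two (α := ℝ)),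
    ← sqrt_mul (by positivity), sqrt_sq zero_le_two]
  ring_nf

lemma isProbabilityMeasure_levyMeasure {c : ℝ} (hc : 0 < c) :
    IsProbabilityMeasure (levyMeasure c) := by
  refine ⟨?_⟩
  have hi := integrable_levyDensity_mul_exp hc le_rfl
  have h := integral_levyDensity_mul_exp hc le_rfl
  simp only [neg_zero, zero_mul, exp_zero, mul_one, mul_zero, sqrt_zero] at hi h
  rw [levyMeasure, withDensity_apply _ MeasurableSet.univ, Measure.restrict_univ,
    ← ofReal_integral_eq_lintegral_ofReal hi (ae_of_all _ (levyDensity_nonneg c)), h,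
    ENNReal.ofReal_one]

lemma ae_nonneg_levyMeasure (c : ℝ) : ∀ᵐ x ∂levyMeasure c, 0 ≤ x := by
  rw [levyMeasure, ae_withDensity_iff (measurable_levyDensity c).ennreal_ofReal]
  refine ae_of_all _ fun x hx => ?_
  contrapose! hx
  simp [levyDensity, hx.not_gt]

lemma mgf_levyMeasure {c t : ℝ} (hc : 0 < c) (ht : t ≤ 0) :
    mgf id (levyMeasure c) t = exp (-√(2 * c * -t)) := by
  rw [← integral_levyDensity_mul_exp hc (neg_nonneg.2 ht), mgf, levyMeasure,
    integral_withDensity_eq_integral_toReal_smul (measurable_levyDensity c).ennreal_ofReal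
      (ae_of_all _ fun _ => ENNReal.ofReal_lt_top)]
  simp [ENNReal.toReal_ofReal (levyDensity_nonneg c _)]

lemma Iio_subset_interior_integrableExpSet {μ : Measure ℝ} [IsFiniteMeasure μ]
    (hμ : ∀ᵐ x ∂μ, 0 ≤ x) : Iio 0 ⊆ interior (integrableExpSet id μ) := by
  refine interior_maximal (fun t ht => ?_) isOpen_Iio
  refine (integrable_const (1 : ℝ)).mono' (by fun_prop) ?_
  filter_upwards [hμ] with x hx
  rw [norm_eq_abs, abs_exp, exp_le_one_iff]
  exact mul_nonpos_of_nonpos_of_nonneg (mem_Iio.1 ht).le hx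

lemma tendsto_complexMGF_id_add_mul_I {μ : Measure ℝ} [IsFiniteMeasure μ]
    (hμ : ∀ᵐ x ∂μ, 0 ≤ x) (t : ℝ) :
    Tendsto (fun s : ℝ => complexMGF id μ (s + t * Complex.I)) (𝓝[<] 0) (𝓝 (charFun μ t)) := by
  simp only [charFun_apply_real, complexMGF]
  refine tendsto_integral_filter_of_dominated_convergence (fun _ => 1)
    (Eventually.of_forall fun s => by fun_prop) ?_ (integrable_const 1) ?_
  · filter_upwards [self_mem_nhdsWithin] with s hs
    filter_upwards [hμ] with x hx
    rw [Complex.norm_exp, exp_le_one_iff]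
    simpa using mul_nonpos_of_nonpos_of_nonneg (mem_Iio.1 hs).le hx
  · refine ae_of_all _ fun x => tendsto_nhdsWithin_of_tendsto_nhds ?_
    have h : Continuous fun s : ℝ => Complex.exp ((s + t * Complex.I) * (id x : ℝ)) := by fun_prop
    convert h.tendsto 0 using 2
    simp
    ring_nf

/-- Two finite measures on the nonnegative reals with the same Laplace transform are equal. -/
theorem ext_of_mgf_eq_of_neg {μ ν : Measure ℝ} [IsFiniteMeasure μ] [IsFiniteMeasure ν]
    (hμ : ∀ᵐ x ∂μ, 0 ≤ x) (hν : ∀ᵐ x ∂ν, 0 ≤ x)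
    (h : ∀ t < 0, mgf id μ t = mgf id ν t) : μ = ν := by
  have hU : IsPreconnected {z : ℂ | z.re < 0} := (convex_halfSpace_re_lt 0).isPreconnected
  have hanalytic {ρ : Measure ℝ} [IsFiniteMeasure ρ] (hρ : ∀ᵐ x ∂ρ, 0 ≤ x) :
      AnalyticOnNhd ℂ (complexMGF id ρ) {z : ℂ | z.re < 0} := fun z hz =>
    analyticAt_complexMGF (Iio_subset_interior_integrableExpSet hρ hz)
  have heq : EqOn (complexMGF id μ) (complexMGF id ν) {z : ℂ | z.re < 0} := by
    refine (hanalytic hμ).eqOn_of_preconnected_of_frequently_eq (hanalytic hν) hU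
      (z₀ := ((-1 : ℝ) : ℂ)) (by simp) ?_
    have hreal : ∃ᶠ x : ℝ in 𝓝[≠] (-1 : ℝ), complexMGF id μ x = complexMGF id ν x := by
      refine Eventually.frequently ?_
      filter_upwards [nhdsWithin_le_nhds (Iio_mem_nhds (by norm_num : (-1 : ℝ) < 0))] with x hx
      rw [complexMGF_ofReal, complexMGF_ofReal, h x hx]
    refine Tendsto.frequently (tendsto_nhdsWithin_iff.2 ⟨?_, ?_⟩) hreal
    · exact Complex.continuous_ofReal.continuousWithinAt
    · filter_upwards [self_mem_nhdsWithin] with x hx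
      exact fun h => hx (Complex.ofReal_injective h)
  refine Measure.ext_of_charFun (funext fun t => ?_)
  refine tendsto_nhds_unique (tendsto_complexMGF_id_add_mul_I hμ t)
    ((tendsto_complexMGF_id_add_mul_I hν t).congr' ?_)
  filter_upwards [self_mem_nhdsWithin] with s hs
  exact (heq (by simpa using hs)).symm

/-- The Lévy distribution is stable of index `1/2`: if `X 1, …, X n` are independent
Lévy(`c`) random variables, then `n⁻² ∑ X i` again has the Lévy(`c`) distribution;
equivalently, the pushforward of the `n`-fold product of Lévy(`c`) under
`x ↦ n⁻² ∑ i, x i` is Lévy(`c`). -/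
theorem levy_stable_half (c : ℝ) (hc : 0 < c) (n : ℕ) (hn : 1 ≤ n) :
    Measure.map (fun x : Fin n → ℝ => ((n : ℝ) ^ 2)⁻¹ * ∑ i, x i)
        (Measure.pi fun _ : Fin n => levyMeasure c)
      = levyMeasure c := by
  have := isProbabilityMeasure_levyMeasure hc
  have hmeas : Measurable fun x : Fin n → ℝ => ((n : ℝ) ^ 2)⁻¹ * ∑ i, x i := by fun_prop
  have := Measure.isProbabilityMeasure_map
    (μ := Measure.pi fun _ : Fin n => levyMeasure c) hmeas.aemeasurable
  refine ext_of_mgf_eq_of_neg ?_ (ae_nonneg_levyMeasure c) fun t ht => ?_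
  · rw [ae_map_iff hmeas.aemeasurable measurableSet_Ici]
    have h : ∀ᵐ x ∂Measure.pi fun _ : Fin n => levyMeasure c, ∀ i, 0 ≤ x i :=
      ae_all_iff.2 fun i => (Measure.quasiMeasurePreserving_eval _ i).ae (ae_nonneg_levyMeasure c)
    filter_upwards [h] with x hx
    exact mul_nonneg (by positivity) (Finset.sum_nonneg fun i _ => hx i)
  · have hn' : (0 : ℝ) < n := by exact_mod_cast hn
    have hs : t * ((n : ℝ) ^ 2)⁻¹ ≤ 0 := mul_nonpos_of_nonpos_of_nonneg ht.le (by positivity)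
    have hpow : mgf id (Measure.map (fun x : Fin n → ℝ => ((n : ℝ) ^ 2)⁻¹ * ∑ i, x i)
        (Measure.pi fun _ : Fin n => levyMeasure c)) t
        = mgf id (levyMeasure c) (t * ((n : ℝ) ^ 2)⁻¹) ^ n := by
      have h := integral_fintype_prod_eq_pow (ι := Fin n) (μ := levyMeasure c)
        fun x => exp (t * ((n : ℝ) ^ 2)⁻¹ * x)
      rw [Fintype.card_fin] at h
      rw [mgf_id_map hmeas.aemeasurable]
      simp only [mgf, id, ← mul_assoc]
      simp only [← h, ← exp_sum, ← Finset.mul_sum]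
    rw [hpow, mgf_levyMeasure hc hs, mgf_levyMeasure hc ht.le, ← exp_nat_mul]
    have : 2 * c * -(t * ((n : ℝ) ^ 2)⁻¹) = 2 * c * -t / (n : ℝ) ^ 2 := by ring
    rw [this, sqrt_div' _ (by positivity), sqrt_sq hn'.le]
    congr 1
    field_simp
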